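/- Every 2k-edge-connected finite multigraph admits an orientation D such that D is k-arc-strong and, for every vertex v, the in-degree and out-degree of v in D differ by at most 1. -/

import Mathlib

open Relation

/-- A multigraph on `V` is given by a symmetric loopless multiplicity
function `m : V → V → ℕ` (the number of parallel edges between two vertices).
It is `k`-edge-connected if after removing fewer than `k` edges (a symmetric
removal function `r ≤ m`; each removed edge is counted twice in the ordered
double sum) the remaining multigraph is connected. -/
def MultigraphEdgeConn {V : Type} [Fintype V] (m : V → V → ℕ) (k : ℕ) : Prop :=
  ∀ r : V → V → ℕ, (∀ u v, r u v = r v u) → (∀ u v, r u v ≤ m u v) →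
    (∑ u : V, ∑ v : V, r u v) < 2 * k →
    ∀ x y : V, ReflTransGen (fun a b => r a b < m a b) x y

/-- An orientation `d` of the multigraph `m` (i.e. `d u v + d v u = m u v`) is
`k`-arc-strong if removing any set of at most `k - 1` arcs leaves it strongly
connected. -/
def ArcStrong {V : Type} [Fintype V] (d : V → V → ℕ) (k : ℕ) : Prop :=
  ∀ r : V → V → ℕ, (∀ u v, r u v ≤ d u v) →
    (∑ u : V, ∑ v : V, r u v) < k →
    ∀ x y : V, ReflTransGen (fun a b => r a b < d a b) x y


namespace NW

set_option linter.unusedSectionVars false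

variable {V : Type} [Fintype V] [DecidableEq V]

/-- Number of arcs leaving `X`. -/
def cut (d : V → V → ℕ) (X : Finset V) : ℕ :=
  ∑ u, ∑ v, if u ∈ X ∧ v ∉ X then d u v else 0

/-- A single arc from `a` to `b`. -/
def dl (a b : V) : V → V → ℕ := fun x y => if x = a ∧ y = b then 1 else 0

def outd (d : V → V → ℕ) (w : V) : ℕ := ∑ v, d w v

def ind (d : V → V → ℕ) (w : V) : ℕ := ∑ v, d v w

/-- `X` splits `T`. -/
def Spl (T X : Finset V) : Prop := (∃ a ∈ T, a ∈ X) ∧ (∃ b ∈ T, b ∉ X)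

theorem Spl.compl {T X : Finset V} (h : Spl T X) : Spl T Xᶜ := by
  obtain ⟨⟨a, ha, hb⟩, c, hc, hd⟩ := h
  exact ⟨⟨c, hc, by simpa using hd⟩, a, ha, by simpa using hb⟩

theorem cut_add (f g : V → V → ℕ) (X : Finset V) : cut (f + g) X = cut f X + cut g X := by
  simp only [cut, ← Finset.sum_add_distrib]
  refine Finset.sum_congr rfl fun u _ => Finset.sum_congr rfl fun v _ => ?_
  split_ifs <;> simp

theorem outd_add (f g : V → V → ℕ) (w : V) : outd (f + g) w = outd f w + outd g w := by
  simp [outd, Finset.sum_add_distrib]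

theorem ind_add (f g : V → V → ℕ) (w : V) : ind (f + g) w = ind f w + ind g w := by
  simp [ind, Finset.sum_add_distrib]

theorem cut_dl (a b : V) (X : Finset V) : cut (dl a b) X = if a ∈ X ∧ b ∉ X then 1 else 0 := by
  unfold cut dl
  rw [Finset.sum_eq_single a, Finset.sum_eq_single b]
  · simp
  · intro c _ hc; simp [hc]
  · simp
  · intro c _ hc; simp [hc]
  · simp

theorem outd_dl (a b w : V) : outd (dl a b) w = if w = a then 1 else 0 := by
  unfold outd dl
  by_cases h : w = a <;> simp [h]

theorem ind_dl (a b w : V) : ind (dl a b) w = if w = b then 1 else 0 := by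
  unfold ind dl
  by_cases h : w = b <;> simp [h]

theorem cut_compl {m : V → V → ℕ} (hs : ∀ u v, m u v = m v u) (X : Finset V) :
    cut m Xᶜ = cut m X := by
  unfold cut
  rw [Finset.sum_comm]
  refine Finset.sum_congr rfl fun u _ => Finset.sum_congr rfl fun v _ => ?_
  rw [hs v u]
  simp [and_comm]

theorem cut_transp (d : V → V → ℕ) (X : Finset V) :
    cut (fun x y => d y x) X = cut d Xᶜ := by
  unfold cut
  rw [Finset.sum_comm]
  refine Finset.sum_congr rfl fun u _ => Finset.sum_congr rfl fun v _ => ?_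
  simp [and_comm]

theorem submod (d : V → V → ℕ) (X Y : Finset V) :
    cut d (X ∩ Y) + cut d (X ∪ Y) ≤ cut d X + cut d Y := by
  simp only [cut, ← Finset.sum_add_distrib]
  refine Finset.sum_le_sum fun u _ => Finset.sum_le_sum fun v _ => ?_
  by_cases h1 : u ∈ X <;> by_cases h2 : u ∈ Y <;> by_cases h3 : v ∈ X <;> by_cases h4 : v ∈ Y <;>
    simp [h1, h2, h3, h4]

theorem submod_gap (d : V → V → ℕ) (X Y : Finset V) (a b : V) (ha : a ∈ X) (ha' : a ∉ Y)
    (hb : b ∉ X) (hb' : b ∈ Y) (hs : ∀ u v, d u v = d v u) :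
    cut d (X ∩ Y) + cut d (X ∪ Y) + 2 * d a b ≤ cut d X + cut d Y := by
  have hab : a ≠ b := by rintro rfl; exact hb ha
  obtain ⟨f, hf⟩ : ∃ f : V → V → ℕ, d = f + (d a b) • (dl a b + dl b a) := by
    refine ⟨d - (d a b) • (dl a b + dl b a), ?_⟩
    rw [tsub_add_cancel_of_le]
    intro x y
    have := hs a b
    simp only [dl, Pi.smul_apply, Pi.add_apply, smul_eq_mul]
    split_ifs <;> grind
  have hn : ∀ (n : ℕ) (g : V → V → ℕ) Z, cut (n • g) Z = n * cut g Z := by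
    intro n g Z
    induction n with
    | zero => simp [cut]
    | succ n ih => rw [succ_nsmul, cut_add, ih]; ring
  have hc : ∀ Z, cut d Z = cut f Z + d a b *
      ((if a ∈ Z ∧ b ∉ Z then 1 else 0) + (if b ∈ Z ∧ a ∉ Z then 1 else 0)) := by
    intro Z
    conv_lhs => rw [hf]
    rw [cut_add, hn, cut_add, cut_dl, cut_dl]
  rw [hc, hc, hc X, hc Y]
  have := submod f X Y
  simp [ha, ha', hb, hb']
  omega

/-- arcs from `A` to `B` -/
def ee (m : V → V → ℕ) (A B : Finset V) : ℕ := ∑ a ∈ A, ∑ b ∈ B, m a b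

theorem cut_union {m : V → V → ℕ} (hs : ∀ u v, m u v = m v u) (A B : Finset V)
    (hd : Disjoint A B) : cut m A + cut m B = cut m (A ∪ B) + 2 * ee m A B := by
  have h1 : ee m A B = ∑ u, ∑ v, if u ∈ A ∧ v ∈ B then m u v else 0 := by
    unfold ee
    rw [← Finset.sum_filter_add_sum_filter_not Finset.univ (· ∈ A)]
    rw [Finset.sum_eq_zero (s := Finset.filter (fun x => ¬ x ∈ A) _)]
    · simp only [Finset.filter_mem_eq_inter, Finset.univ_inter, add_zero]
      refine Finset.sum_congr rfl fun u hu => ?_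
      simp [hu]
    · intro x hx
      simp at hx
      simp [hx]
  have h2 : ee m A B = ∑ u, ∑ v, if v ∈ A ∧ u ∈ B then m u v else 0 := by
    rw [h1, Finset.sum_comm]
    refine Finset.sum_congr rfl fun u _ => Finset.sum_congr rfl fun v _ => ?_
    rw [hs]
  rw [two_mul]
  nth_rw 1 [h1]
  rw [h2]
  simp only [cut, ← Finset.sum_add_distrib]
  refine Finset.sum_congr rfl fun u _ => Finset.sum_congr rfl fun v _ => ?_
  have e1 : u ∈ A → u ∉ B := fun h h' => Finset.disjoint_left.1 hd h h'
  have e2 : v ∈ A → v ∉ B := fun h h' => Finset.disjoint_left.1 hd h h'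
  by_cases h1 : u ∈ A <;> by_cases h2 : u ∈ B <;> by_cases h3 : v ∈ A <;> by_cases h4 : v ∈ B <;>
    simp_all

theorem cut_congr {m : V → V → ℕ} {X Y : Finset V}
    (h : ∀ u v, m u v ≠ 0 → ((u ∈ X ↔ u ∈ Y) ∧ (v ∈ X ↔ v ∈ Y))) : cut m X = cut m Y := by
  unfold cut
  refine Finset.sum_congr rfl fun u _ => Finset.sum_congr rfl fun v _ => ?_
  by_cases h0 : m u v = 0
  · simp [h0]
  · obtain ⟨h1, h2⟩ := h u v h0
    simp [h1, h2]

theorem cut_single (d : V → V → ℕ) (z : V) (hz : d z z = 0) : cut d {z} = outd d z := by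
  unfold cut outd
  rw [Finset.sum_eq_single z]
  · refine Finset.sum_congr rfl fun v _ => ?_
    by_cases h : v = z <;> simp [h, hz]
  · intro b _ hb; simp [hb]
  · simp

theorem cut_single_compl (d : V → V → ℕ) (z : V) (hz : d z z = 0) : cut d {z}ᶜ = ind d z := by
  rw [← cut_transp]
  exact cut_single (fun x y => d y x) z hz

theorem sum_imb (d : V → V → ℕ) (A : Finset V) :
    ∑ w ∈ A, ((outd d w : ℤ) - ind d w) = cut d A - cut d Aᶜ := by
  have h1 : ∀ d : V → V → ℕ, ∑ w ∈ A, outd d w = ∑ u, ∑ v, if u ∈ A then d u v else 0 := by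
    intro d
    rw [← Finset.sum_filter_add_sum_filter_not Finset.univ (· ∈ A)]
    rw [Finset.sum_eq_zero (s := Finset.filter (fun x => ¬ x ∈ A) _)]
    · simp only [Finset.filter_mem_eq_inter, Finset.univ_inter, add_zero]
      refine Finset.sum_congr rfl fun u hu => ?_
      simp [hu, outd]
    · intro x hx
      simp at hx
      simp [hx]
  have h2 : ∑ w ∈ A, ind d w = ∑ u, ∑ v, if v ∈ A then d u v else 0 := by
    rw [Finset.sum_comm]
    exact h1 fun x y => d y x
  have h3 : ∑ w ∈ A, outd d w + cut d Aᶜ = ∑ w ∈ A, ind d w + cut d A := by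
    rw [h1, h2]
    simp only [cut, ← Finset.sum_add_distrib]
    refine Finset.sum_congr rfl fun u _ => Finset.sum_congr rfl fun v _ => ?_
    by_cases h1 : u ∈ A <;> by_cases h3 : v ∈ A <;> simp [h1, h3]
  rw [Finset.sum_sub_distrib]
  have : ((∑ w ∈ A, outd d w + cut d Aᶜ : ℕ) : ℤ) = ((∑ w ∈ A, ind d w + cut d A : ℕ) : ℤ) := by
    rw [h3]
  push_cast at this
  linarith

theorem cut_reach {r : V → V → Prop} {x y : V} (d e : V → V → ℕ)
    (hd : ∀ a b, ¬ r a b → d a b ≤ e a b) (h : ¬ ReflTransGen r x y) :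
    ∃ X : Finset V, x ∈ X ∧ y ∉ X ∧ cut d X ≤ cut e X := by
  classical
  refine ⟨Finset.univ.filter (fun w => ReflTransGen r x w), by simp [ReflTransGen.refl],
    by simp [h], ?_⟩
  unfold cut
  refine Finset.sum_le_sum fun u _ => Finset.sum_le_sum fun v _ => ?_
  split_ifs with hc
  · apply hd
    intro hr
    simp at hc
    exact hc.2 (hc.1.tail hr)
  · exact le_rfl

theorem cut_le_sum (d : V → V → ℕ) (X : Finset V) : cut d X ≤ ∑ u, ∑ v, d u v := by
  unfold cut
  refine Finset.sum_le_sum fun u _ => Finset.sum_le_sum fun v _ => ?_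
  split_ifs <;> simp


theorem last_visit {r : V → V → Prop} {u v : V} (h : ReflTransGen r u v) :
    u = v ∨ ∃ b, b ≠ u ∧ r u b ∧ ReflTransGen (fun a c => r a c ∧ a ≠ u ∧ c ≠ u) b v := by
  induction h with
  | refl => exact Or.inl rfl
  | @tail a c _ hr ih =>
    by_cases hc : u = c
    · exact Or.inl hc
    right
    by_cases ha : u = a
    · subst ha
      exact ⟨c, Ne.symm hc, hr, ReflTransGen.refl⟩
    rcases ih with h | ⟨b, hb, hub, hp⟩
    · exact absurd h ha
    · exact ⟨b, hb, hub, hp.tail ⟨hr, Ne.symm ha, Ne.symm hc⟩⟩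

theorem path_rev (n : ℕ) : ∀ (W : Finset V) (d : V → V → ℕ) (u v : V), Wᶜ.card ≤ n → u ∉ W →
    ReflTransGen (fun a b => 0 < d a b ∧ a ∉ W ∧ b ∉ W) u v →
    ∃ d' : V → V → ℕ, (∀ x y, d' x y + d' y x = d x y + d y x) ∧
      (∀ X : Finset V, cut d' X + (if u ∈ X then 1 else 0) = cut d X + (if v ∈ X then 1 else 0)) ∧
      (∀ w, outd d' w + (if w = u then 1 else 0) = outd d w + (if w = v then 1 else 0)) ∧
      (∀ w, ind d' w + (if w = v then 1 else 0) = ind d w + (if w = u then 1 else 0)) := by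
  induction n with
  | zero =>
    intro W d u v hn hu
    simp at hn
    simp [hn] at hu
  | succ n ih =>
    intro W d u v hn hu h
    rcases last_visit h with rfl | ⟨b, hb, ⟨hub, _, hbW⟩, hp⟩
    · exact ⟨d, by simp, by simp, by simp, by simp⟩
    obtain ⟨d1, h1⟩ : ∃ d1 : V → V → ℕ, d1 + dl u b = d + dl b u := by
      refine ⟨d + dl b u - dl u b, ?_⟩
      rw [tsub_add_cancel_of_le]
      intro x y
      simp only [dl, Pi.add_apply]
      split_ifs <;> grind
    have h1' : ∀ x y, d1 x y + dl u b x y = d x y + dl b u x y := fun x y => by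
      have := congrFun (congrFun h1 x) y
      simpa using this
    have hcard : (insert u W)ᶜ.card ≤ n := by
      have : (insert u W)ᶜ.card < Wᶜ.card := by
        apply Finset.card_lt_card
        rw [Finset.ssubset_iff_of_subset]
        · exact ⟨u, by simpa using hu, by simp⟩
        · intro x; simp
      omega
    obtain ⟨d', e1, e2, e3, e4⟩ := ih (insert u W) d1 b v hcard (by simp [hb, hbW]) (by
      refine ReflTransGen.mono ?_ b v hp
      rintro a c ⟨⟨h2, h3, h4⟩, h5, h6⟩
      refine ⟨?_, by simp [h3, h5], by simp [h4, h6]⟩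
      have := h1' a c
      simp [dl, h5, h6] at this
      omega)
    refine ⟨d', ?_, ?_, ?_, ?_⟩
    · intro x y
      rw [e1]
      have a1 := h1' x y
      have a2 := h1' y x
      have a3 : dl u b x y = dl b u y x := by simp [dl, and_comm]
      have a4 : dl u b y x = dl b u x y := by simp [dl, and_comm]
      omega
    · intro X
      have a1 := e2 X
      have a2 : cut (d1 + dl u b) X = _ := congrArg (fun f => cut f X) h1
      simp only [cut_add, cut_dl] at a2
      by_cases p : u ∈ X <;> by_cases q : b ∈ X <;> simp [p, q] at a1 a2 ⊢ <;> omega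
    · intro w
      have a1 := e3 w
      have a2 : outd (d1 + dl u b) w = _ := congrArg (fun f => outd f w) h1
      simp only [outd_add, outd_dl] at a2
      omega
    · intro w
      have a1 := e4 w
      have a2 : ind (d1 + dl u b) w = _ := congrArg (fun f => ind f w) h1
      simp only [ind_add, ind_dl] at a2
      omega

theorem fam_sum (P : Finset V → Prop) (g : V → ℤ)
    (hU : ∀ A B, P A → P B → (A ∩ B).Nonempty → P (A ∪ B))
    (hg : ∀ A, P A → 0 ≤ ∑ w ∈ A, g w) (n : ℕ) :
    ∀ F : Finset (Finset V), F.card ≤ n → (∀ A ∈ F, P A) → 0 ≤ ∑ w ∈ F.biUnion id, g w := by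
  induction n with
  | zero =>
    intro F hF _
    simp at hF
    simp [hF]
  | succ n ih =>
    intro F hF hP
    by_cases hd : (F : Set (Finset V)).PairwiseDisjoint id
    · rw [Finset.sum_biUnion hd]
      exact Finset.sum_nonneg fun A hA => hg A (hP A hA)
    · obtain ⟨A, hA, B, hB, hne, hAB⟩ : ∃ A ∈ F, ∃ B ∈ F, A ≠ B ∧ ¬ Disjoint A B := by
        by_contra hcon
        push Not at hcon
        exact hd fun A hA B hB hne => hcon A hA B hB hne
      have hAB' : (A ∩ B).Nonempty := by
        rwa [Finset.disjoint_iff_inter_eq_empty, ← ne_eq, ← Finset.nonempty_iff_ne_empty] at hAB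
      have key := ih (insert (A ∪ B) ((F.erase A).erase B)) (by
        have h1 := Finset.card_insert_le (A ∪ B) ((F.erase A).erase B)
        have h2 : ((F.erase A).erase B).card = (F.erase A).card - 1 :=
          Finset.card_erase_of_mem (Finset.mem_erase.2 ⟨hne.symm, hB⟩)
        have h3 : (F.erase A).card = F.card - 1 := Finset.card_erase_of_mem hA
        have h4 : 0 < (F.erase A).card := Finset.card_pos.2 ⟨B, Finset.mem_erase.2 ⟨hne.symm, hB⟩⟩
        omega) (by
        intro C hC
        rw [Finset.mem_insert] at hC
        rcases hC with rfl | hC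
        · exact hU A B (hP A hA) (hP B hB) hAB'
        · exact hP C (Finset.mem_of_mem_erase (Finset.mem_of_mem_erase hC)))
      have : (insert (A ∪ B) ((F.erase A).erase B)).biUnion id = F.biUnion id := by
        ext x
        simp only [Finset.mem_biUnion, Finset.mem_insert, Finset.mem_erase, id]
        constructor
        · rintro ⟨C, rfl | ⟨_, _, hC⟩, hx⟩
          · rcases Finset.mem_union.1 hx with h | h
            · exact ⟨A, hA, h⟩
            · exact ⟨B, hB, h⟩
          · exact ⟨C, hC, hx⟩
        · rintro ⟨C, hC, hx⟩
          by_cases h1 : C = A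
          · exact ⟨A ∪ B, Or.inl rfl, by subst h1; simp [hx]⟩
          by_cases h2 : C = B
          · exact ⟨A ∪ B, Or.inl rfl, by subst h2; simp [hx]⟩
          exact ⟨C, Or.inr ⟨h2, h1, hC⟩, hx⟩
      rwa [this] at key

def imb (d : V → V → ℕ) (w : V) : ℤ := (outd d w : ℤ) - ind d w

theorem smooth_step (d : V → V → ℕ) (k : ℕ)
    (hk : ∀ X : Finset V, Spl Finset.univ X → k ≤ cut d X) (u : V) (hu : 2 ≤ imb d u) :
    ∃ d' : V → V → ℕ, (∀ x y, d' x y + d' y x = d x y + d y x) ∧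
      (∀ X : Finset V, Spl Finset.univ X → k ≤ cut d' X) ∧
      ∑ w, (imb d' w) ^ 2 < ∑ w, (imb d w) ^ 2 := by
  classical
  let P : Finset V → Prop := fun A => A.Nonempty ∧ u ∉ A ∧ cut d Aᶜ = k
  have hU : ∀ A B, P A → P B → (A ∩ B).Nonempty → P (A ∪ B) := by
    rintro A B ⟨⟨a, ha⟩, huA, hA⟩ ⟨_, huB, hB⟩ ⟨c, hc⟩
    refine ⟨⟨a, by simp [ha]⟩, by simp [huA, huB], ?_⟩
    have h1 := submod d Aᶜ Bᶜ
    rw [← Finset.compl_union, ← Finset.compl_inter] at h1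
    have h2 := hk (A ∪ B)ᶜ ⟨⟨u, by simp, by simp [huA, huB]⟩, a, by simp, by simp [ha]⟩
    have h3 := hk (A ∩ B)ᶜ ⟨⟨u, by simp, by simp [huA]⟩, c, by simp, by simpa using hc⟩
    omega
  have hg : ∀ A, P A → 0 ≤ ∑ w ∈ A, imb d w := by
    rintro A ⟨⟨a, ha⟩, huA, hA⟩
    unfold imb
    rw [sum_imb, hA]
    have := hk A ⟨⟨a, by simp, ha⟩, u, by simp, huA⟩
    omega
  set N := (Finset.univ.filter P).biUnion id with hN
  have hN0 : 0 ≤ ∑ w ∈ N, imb d w :=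
    fam_sum P (imb d) hU hg _ (Finset.univ.filter P) le_rfl (by simp)
  have huN : u ∈ Nᶜ := by
    simp only [hN, Finset.mem_compl, Finset.mem_biUnion, Finset.mem_filter, id]
    rintro ⟨A, ⟨_, hA⟩, h⟩
    exact hA.2.1 h
  have htot : ∑ w, imb d w = 0 := by
    unfold imb
    rw [sum_imb]
    simp [cut]
  have hNc : ∑ w ∈ Nᶜ, imb d w ≤ 0 := by
    have := Finset.sum_add_sum_compl N (imb d)
    omega
  obtain ⟨v, hvN, hv⟩ : ∃ v ∈ Nᶜ, imb d v < 0 := by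
    by_contra hcon
    push Not at hcon
    have := Finset.single_le_sum hcon huN
    omega
  have hcut : ∀ X : Finset V, u ∈ X → v ∉ X → k + 1 ≤ cut d X := by
    intro X h1 h2
    have h3 := hk X ⟨⟨u, by simp, h1⟩, v, by simp, h2⟩
    rcases h3.lt_or_eq with h | h
    · exact h
    · exfalso
      simp only [hN, Finset.mem_compl, Finset.mem_biUnion, Finset.mem_filter, id] at hvN
      refine hvN ⟨Xᶜ, ⟨by simp, ⟨v, by simpa using h2⟩, by simpa using h1, by simp [h]⟩, by simpa using h2⟩
  have hreach : ReflTransGen (fun a b => 0 < d a b) u v := by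
    by_contra hcon
    obtain ⟨X, h1, h2, h3⟩ := cut_reach d (fun _ _ => 0) (by intro a b; simp) hcon
    have := hcut X h1 h2
    have h0 : cut (fun _ _ : V => 0) X = 0 := by simp [cut]
    omega
  obtain ⟨d', e1, e2, e3, e4⟩ := path_rev _ ∅ d u v le_rfl (by simp) (by simpa using hreach)
  refine ⟨d', e1, ?_, ?_⟩
  · intro X hX
    have h1 := e2 X
    have h2 := hk X hX
    by_cases p : u ∈ X <;> by_cases q : v ∈ X <;> simp [p, q] at h1
    · omega
    · have := hcut X p q
      omega
    · omega
    · omega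
  · have huv : u ≠ v := by rintro rfl; omega
    have hi : ∀ w, (imb d' w) ^ 2 = (imb d w) ^ 2 + ((if w = u then 4 - 4 * imb d w else 0) +
        (if w = v then 4 + 4 * imb d w else 0)) := by
      intro w
      have h3 := e3 w
      have h4 := e4 w
      unfold imb
      by_cases p : w = u
      · have q : w ≠ v := by rw [p]; exact huv
        simp only [p, if_true, huv, if_false] at h3 h4 ⊢
        have : (ind d' u : ℤ) = ind d u + 1 := by omega
        have h5 : (outd d' u : ℤ) = outd d u - 1 := by omega
        rw [this, h5]; ring
      · by_cases q : w = v
        · simp only [q, if_true, huv.symm, if_false] at h3 h4 ⊢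
          have : (ind d' v : ℤ) = ind d v - 1 := by omega
          have h5 : (outd d' v : ℤ) = outd d v + 1 := by omega
          rw [this, h5]; ring
        · simp only [p, q, if_false, add_zero] at h3 h4 ⊢
          rw [h3, h4]
    rw [Finset.sum_congr rfl fun w _ => hi w]
    rw [Finset.sum_add_distrib, Finset.sum_add_distrib]
    simp
    omega

theorem smooth (n : ℕ) : ∀ (d : V → V → ℕ) (k : ℕ),
    (∀ X : Finset V, Spl Finset.univ X → k ≤ cut d X) → ∑ w, (imb d w) ^ 2 ≤ (n : ℤ) →
    ∃ d' : V → V → ℕ, (∀ x y, d' x y + d' y x = d x y + d y x) ∧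
      (∀ X : Finset V, Spl Finset.univ X → k ≤ cut d' X) ∧ ∀ w, |imb d' w| ≤ 1 := by
  induction n with
  | zero =>
    intro d k hk hn
    refine ⟨d, by simp, hk, fun w => ?_⟩
    have h1 : (imb d w) ^ 2 ≤ ∑ w, (imb d w) ^ 2 := Finset.single_le_sum (f := fun w => (imb d w) ^ 2) (s := Finset.univ)
      (fun _ _ => sq_nonneg _) (Finset.mem_univ w)
    have h2 : (imb d w) ^ 2 ≤ 1 := by
      push_cast at hn
      linarith
    rw [← sq_le_one_iff_abs_le_one]
    exact h2
  | succ n ih =>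
    intro d k hk hn
    by_cases hall : ∀ w, |imb d w| ≤ 1
    · exact ⟨d, by simp, hk, hall⟩
    push Not at hall
    obtain ⟨u, hu⟩ := hall
    rcases lt_abs.1 hu with h | h
    · obtain ⟨d', e1, e2, e3⟩ := smooth_step d k hk u (by omega)
      obtain ⟨d'', f1, f2, f3⟩ := ih d' k e2 (by push_cast at hn; omega)
      exact ⟨d'', fun x y => by rw [f1, e1], f2, f3⟩
    · have hi : ∀ w, imb (fun x y => d y x) w = - imb d w := by
        intro w; unfold imb outd ind; ring
      obtain ⟨d', e1, e2, e3⟩ := smooth_step (fun x y => d y x) k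
        (fun X hX => by rw [cut_transp]; exact hk _ hX.compl) u (by rw [hi]; omega)
      simp only [hi, neg_sq] at e3
      obtain ⟨d'', f1, f2, f3⟩ := ih d' k e2 (by push_cast at hn; omega)
      exact ⟨d'', fun x y => by rw [f1, e1, add_comm], f2, f3⟩


/-- Lovász splitting. -/
theorem split_exists (T : Finset V) (m : V → V → ℕ) (k : ℕ) (hs : ∀ u v, m u v = m v u)
    (hl : ∀ v, m v v = 0) (hc : ∀ X, Spl T X → 2 * k ≤ cut m X) (z u : V) (hz : z ∉ T)
    (hzT : ∀ w, m z w ≠ 0 → w ∈ T) (hev : Even (outd m z)) (hu : m z u ≠ 0) :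
    ∃ v, m z v ≠ 0 ∧ (v = u → 2 ≤ m z u) ∧
      ∀ X, Spl T X → z ∉ X → u ∈ X → v ∈ X → 2 * k + 2 ≤ cut m X := by
  classical
  by_contra hcon
  push Not at hcon
  have huT := hzT u hu
  let Dg : Finset V → Prop := fun X => Spl T X ∧ z ∉ X ∧ u ∈ X ∧ cut m X ≤ 2 * k + 1
  have hbad : ∀ v, m z v ≠ 0 → (v = u → 2 ≤ m z u) → ∃ X, Dg X ∧ v ∈ X := by
    intro v h1 h2
    obtain ⟨X, a1, a2, a3, a4, a5⟩ := hcon v h1 h2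
    exact ⟨X, ⟨a1, a2, a3, by omega⟩, a4⟩
  have hw : ∀ X, z ∉ X → ee m X {z} = ∑ x ∈ X, m z x := by
    intro X _
    unfold ee
    refine Finset.sum_congr rfl fun x _ => ?_
    simp [hs x z]
  have hhalf : ∀ X, Dg X → 2 * ∑ x ∈ X, m z x ≤ outd m z := by
    rintro X ⟨⟨⟨a, ha, haX⟩, b, hb, hbX⟩, h2, h3, h4⟩
    have e1 := cut_union hs X {z} (by simpa using h2)
    rw [hw X h2, cut_single m z (hl z)] at e1
    have e2 := hc (X ∪ {z}) ⟨⟨a, ha, by simp [haX]⟩, b, hb, by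
      simp only [Finset.mem_union, Finset.mem_singleton, hbX, false_or]
      rintro rfl
      exact hz hb⟩
    obtain ⟨c, hc⟩ := hev
    omega
  have hpos : ∀ X, u ∈ X → m z u ≤ ∑ x ∈ X, m z x := fun X hX =>
    Finset.single_le_sum (f := fun x => m z x) (fun _ _ => Nat.zero_le _) hX
  have hsub : ∀ X : Finset V, (∀ w, m z w ≠ 0 → w ∈ X) → outd m z = ∑ x ∈ X, m z x := by
    intro X hX
    unfold outd
    symm
    apply Finset.sum_subset (Finset.subset_univ _)
    intro x _ hx
    by_contra h
    exact hx (hX x h)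
  -- there is a dangerous set
  obtain ⟨X0, hX0⟩ : ∃ X, Dg X := by
    by_cases h : 2 ≤ m z u
    · obtain ⟨X, hX, _⟩ := hbad u hu (fun _ => h)
      exact ⟨X, hX⟩
    · have : ∃ v, v ≠ u ∧ m z v ≠ 0 := by
        by_contra hno
        push Not at hno
        have := hsub {u} (by intro w hw; by_contra h; exact hw (hno w (by simpa using h)))
        simp at this
        obtain ⟨c, hc⟩ := hev
        omega
      obtain ⟨v, h1, h2⟩ := this
      obtain ⟨X, hX, _⟩ := hbad v h2 (fun h => absurd h h1)
      exact ⟨X, hX⟩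
  obtain ⟨X, hX, hmax⟩ := Finset.exists_max_image (Finset.univ.filter Dg)
    (fun X => (X ∩ T).card) ⟨X0, by simpa using hX0⟩
  simp only [Finset.mem_filter, Finset.mem_univ, true_and] at hX hmax
  have hXh := hhalf X hX
  obtain ⟨v, hv, hvX⟩ : ∃ v, m z v ≠ 0 ∧ v ∉ X := by
    by_contra hno
    push Not at hno
    have h1 := hsub X hno
    have h2 := hpos X hX.2.2.1
    omega
  have hvu : v ≠ u := by rintro rfl; exact hvX hX.2.2.1
  obtain ⟨Y, hY, hvY⟩ := hbad v hv (fun h => absurd h hvu)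
  have hYh := hhalf Y hY
  have hvT := hzT v hv
  have hlt : ∀ Z, Dg Z → X ∩ T ⊆ Z → v ∈ Z → False := by
    intro Z hZ h1 h2
    have h3 := hmax Z hZ
    have : (X ∩ T).card < (Z ∩ T).card := by
      apply Finset.card_lt_card
      rw [Finset.ssubset_iff_of_subset]
      · exact ⟨v, by simp [h2, hvT], by simp [hvX]⟩
      · intro x hx
        simp only [Finset.mem_inter]
        exact ⟨h1 hx, (Finset.mem_inter.1 hx).2⟩
    omega
  obtain ⟨_, hzX, huX, hXc⟩ := id hX
  obtain ⟨_, hzY, huY, hYc⟩ := id hY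
  obtain ⟨t, htT, ht⟩ : ∃ t ∈ T, t ∉ X ∪ Y := by
    by_contra hno
    push Not at hno
    have h1 := hsub (X ∪ Y) (fun w hw => hno w (hzT w hw))
    have h2 := Finset.sum_union_inter (s₁ := X) (s₂ := Y) (f := fun x => m z x)
    have h3 := hpos (X ∩ Y) (by simp [huX, huY])
    omega
  have ht' : t ∉ X ∧ t ∉ Y := by simpa using ht
  have c1 : 2 * k + 2 ≤ cut m (X ∪ Y) := by
    by_contra hcc
    exact hlt (X ∪ Y) ⟨⟨⟨u, huT, by simp [huX]⟩, t, htT, ht⟩, by simp [hzX, hzY], by simp [huX],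
      by omega⟩ (fun x hx => by simp at hx; simp [hx.1]) (by simp [hvY])
  have c2 := hc (X ∩ Y) ⟨⟨u, huT, by simp [huX, huY]⟩, t, htT, by simp [ht'.1]⟩
  have c3 := submod m X Y
  obtain ⟨s, hsX, hsT, hsY⟩ : ∃ s, s ∈ X ∧ s ∈ T ∧ s ∉ Y := by
    by_contra hno
    push Not at hno
    exact hlt Y hY (fun x hx => by simp at hx; exact hno x hx.1 hx.2) hvY
  have c4 := hc (X \ Y) ⟨⟨s, hsT, by simp [hsX, hsY]⟩, u, huT, by simp [huY]⟩
  have c5 := hc (Y \ X) ⟨⟨v, hvT, by simp [hvX, hvY]⟩, u, huT, by simp [huX]⟩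
  have c6 := submod_gap m X Yᶜ u z huX (by simpa using huY) hzX (by simpa using hzY) hs
  have c7 : X ∩ Yᶜ = X \ Y := by ext; simp
  have c8 : X ∪ Yᶜ = (Y \ X)ᶜ := by ext; simp; tauto
  rw [c7, c8, cut_compl hs, cut_compl hs, hs u z] at c6
  have c9 := cut_union hs (X ∩ Y) (X \ Y) (by
    rw [Finset.disjoint_left]; intro x hx; simp at hx; simp [hx])
  have c10 : X ∩ Y ∪ X \ Y = X := by ext; simp; tauto
  rw [c10] at c9
  omega

/-- Undeletable graph has a vertex of degree `2k`. -/
theorem exists_deg (T : Finset V) (m : V → V → ℕ) (k : ℕ) (hk : 0 < k)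
    (hs : ∀ u v, m u v = m v u)
    (hl : ∀ v, m v v = 0) (hc : ∀ X, Spl T X → 2 * k ≤ cut m X)
    (hT : ∀ a b, m a b ≠ 0 → a ∈ T)
    (ht : ∀ a b, m a b ≠ 0 → ∃ X, Spl T X ∧ cut m X = 2 * k ∧ a ∈ X ∧ b ∉ X)
    (hne : ∃ a b, m a b ≠ 0) : ∃ z ∈ T, outd m z = 2 * k := by
  classical
  obtain ⟨a, b, hab⟩ := hne
  obtain ⟨X0, h1, h2, _⟩ := ht a b hab
  obtain ⟨X, hX, hmin⟩ := Finset.exists_min_image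
    (Finset.univ.filter fun X => Spl T X ∧ cut m X = 2 * k)
    (fun X => (X ∩ T).card) ⟨X0, by simp [h1, h2]⟩
  simp only [Finset.mem_filter, Finset.mem_univ, true_and] at hX hmin
  obtain ⟨⟨⟨z, hzT, hzX⟩, b', hb'T, hb'X⟩, hXc⟩ := hX
  refine ⟨z, hzT, ?_⟩
  have hlt : ∀ Z x, Spl T Z → cut m Z = 2 * k → Z ∩ T ⊆ X → x ∈ X → x ∈ T → x ∉ Z → False := by
    intro Z x a1 a2 a3 a4 a5 a6
    have h3 := hmin Z ⟨a1, a2⟩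
    have : (Z ∩ T).card < (X ∩ T).card := by
      apply Finset.card_lt_card
      rw [Finset.ssubset_iff_of_subset]
      · exact ⟨x, by simp [a4, a5], by simp [a6]⟩
      · intro x hx
        simp only [Finset.mem_inter]
        exact ⟨a3 hx, (Finset.mem_inter.1 hx).2⟩
    omega
  by_cases hone : ∀ x ∈ X, x ∈ T → x = z
  · rw [← cut_single m z (hl z), ← hXc]
    apply cut_congr
    intro p q hpq
    have hp := hT p q hpq
    have hq := hT q p (by rwa [hs])
    simp only [Finset.mem_singleton]
    exact ⟨⟨fun h => by rw [h]; exact hzX, fun h => hone p h hp⟩,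
      ⟨fun h => by rw [h]; exact hzX, fun h => hone q h hq⟩⟩
  · exfalso
    push Not at hone
    obtain ⟨x, hxX, hxT, hxz⟩ := hone
    have e1 := cut_union hs {z} (X.erase z) (by simp)
    have e0 : {z} ∪ X.erase z = X := by
      rw [← Finset.insert_eq, Finset.insert_erase hzX]
    rw [e0] at e1
    have e2 := hc {z} ⟨⟨z, hzT, by simp⟩, x, hxT, by simp [hxz]⟩
    have e3 := hc (X.erase z) ⟨⟨x, hxT, by simp [hxz, hxX]⟩, z, hzT, by simp⟩
    have e4 : ee m {z} (X.erase z) ≠ 0 := by omega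
    obtain ⟨r, hrX, hr⟩ : ∃ r ∈ X.erase z, m z r ≠ 0 := by
      by_contra hno
      push Not at hno
      apply e4
      simp only [ee, Finset.sum_singleton]
      exact Finset.sum_eq_zero hno
    have hrX' := Finset.mem_of_mem_erase hrX
    have hrT := hT r z (by rwa [hs])
    obtain ⟨Y, hY, hYc, hzY, hrY⟩ := ht z r hr
    by_cases hun : ∃ t ∈ T, t ∉ X ∪ Y
    · obtain ⟨t, htT, htt⟩ := hun
      have f1 := submod m X Y
      have s1 : Spl T (X ∩ Y) := ⟨⟨z, hzT, by simp [hzX, hzY]⟩, r, hrT, by simp [hrY]⟩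
      have f2 := hc _ s1
      have f3 := hc (X ∪ Y) ⟨⟨z, hzT, by simp [hzX]⟩, t, htT, htt⟩
      exact hlt (X ∩ Y) r s1 (by omega) (fun w hw => by simp at hw; exact hw.1) hrX' hrT
        (by simp [hrY])
    · push Not at hun
      refine hlt Yᶜ z hY.compl (by rw [cut_compl hs, hYc]) (fun w hw => ?_) hzX hzT (by simp [hzY])
      simp at hw
      have := hun w hw.2
      simp [hw.1] at this
      exact this

theorem orient (n : ℕ) : ∀ (T : Finset V) (m : V → V → ℕ) (k : ℕ),
    T.card + ∑ u, outd m u ≤ n → (∀ u v, m u v = m v u) → (∀ v, Even (m v v)) →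
    (∀ X, Spl T X → 2 * k ≤ cut m X) →
    (∀ w w', w ∉ T → w' ∉ T → outd m w ≠ 0 → outd m w' ≠ 0 → w = w') →
    (∀ w, w ∉ T → Even (outd m w)) →
    ∃ d : V → V → ℕ, (∀ x y, d x y + d y x = m x y) ∧ (∀ X, Spl T X → k ≤ cut d X) ∧
      ∀ w, w ∉ T → outd d w = ind d w := by
  induction n with
  | zero =>
    intro T m k hn _ _ _ _ _
    have hT : T = ∅ := by rw [← Finset.card_eq_zero]; omega
    have h0 : ∀ u v, m u v = 0 := by
      intro u v
      have h1 : ∑ u, outd m u = 0 := by omega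
      rw [Finset.sum_eq_zero_iff] at h1
      have h2 := h1 u (Finset.mem_univ _)
      unfold outd at h2
      rw [Finset.sum_eq_zero_iff] at h2
      exact h2 v (Finset.mem_univ _)
    refine ⟨fun _ _ => 0, by simp [h0], ?_, by simp [outd, ind]⟩
    rintro X ⟨⟨a, ha, _⟩, _⟩
    simp [hT] at ha
  | succ n ih =>
    intro T m k hn hs hl hc hiso hev
    have hnz : ∀ a b, m a b ≠ 0 → outd m a ≠ 0 := by
      intro a b hab h0
      unfold outd at h0
      rw [Finset.sum_eq_zero_iff] at h0
      exact hab (h0 b (Finset.mem_univ _))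
    have hdlsymm : ∀ a b x y : V, dl a b x y = dl b a y x := by
      intro a b x y; simp [dl, and_comm]
    have hsum : ∀ a b : V, ∑ u, outd (dl a b) u = 1 := by
      intro a b; simp [outd_dl]
    -- loops
    by_cases hloop : ∃ a, m a a ≠ 0
    · obtain ⟨a, ha⟩ := hloop
      obtain ⟨m', hm'⟩ : ∃ m' : V → V → ℕ, m' + (dl a a + dl a a) = m := by
        refine ⟨m - (dl a a + dl a a), ?_⟩
        rw [tsub_add_cancel_of_le]
        intro x y
        have := hl a
        simp only [dl, Pi.add_apply]
        split_ifs with h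
        · obtain ⟨rfl, rfl⟩ := h
          obtain ⟨c, hc⟩ := this
          omega
        · simp
      have hp : ∀ x y, m' x y + (dl a a x y + dl a a x y) = m x y := fun x y => by
        rw [← hm']; rfl
      have hcut : ∀ X, cut m X = cut m' X := by
        intro X
        rw [← hm', cut_add, cut_add, cut_dl]
        simp
      have hout : ∀ w, outd m w = outd m' w + 2 * outd (dl a a) w := by
        intro w
        rw [← hm', outd_add, outd_add]; ring
      obtain ⟨d, f1, f2, f3⟩ := ih T m' k (by
          simp only [hout, Finset.sum_add_distrib, ← Finset.mul_sum, hsum] at hn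
          omega)
        (by
          intro u v
          have h1 := hp u v
          have h2 := hp v u
          rw [hs v u, hdlsymm a a v u] at h2
          omega)
        (by
          intro v
          have h1 := hp v v
          have h2 := hl v
          rw [← h1, Nat.even_add] at h2
          exact h2.2 ⟨_, rfl⟩)
        (fun X hX => by rw [← hcut]; exact hc X hX)
        (fun w w' h1 h2 h3 h4 => hiso w w' h1 h2 (by rw [hout]; omega) (by rw [hout]; omega))
        (fun w hw => by
          have h2 := hev w hw
          rw [hout, Nat.even_add] at h2
          exact h2.2 (by simp))
      refine ⟨d + dl a a, ?_, ?_, ?_⟩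
      · intro x y
        have h1 := f1 x y
        have h2 := hp x y
        have h3 := hdlsymm a a x y
        simp only [Pi.add_apply]
        omega
      · intro X hX
        rw [cut_add]
        have := f2 X hX
        omega
      · intro w hw
        rw [outd_add, ind_add, outd_dl, ind_dl, f3 w hw]
    push Not at hloop
    -- splitting off
    by_cases hz : ∃ z, z ∉ T ∧ outd m z ≠ 0
    · obtain ⟨z, hzT, hz0⟩ := hz
      obtain ⟨u, hu⟩ : ∃ u, m z u ≠ 0 := by
        by_contra hno
        push Not at hno
        exact hz0 (by simp [outd, hno])
      have hne : ∀ w, m z w ≠ 0 → w ≠ z := by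
        rintro w hw rfl
        exact hw (hloop _)
      have hzw : ∀ w, m z w ≠ 0 → w ∈ T := by
        intro w hw
        by_contra hwT
        exact hne w hw (hiso w z hwT hzT (hnz w z (by rwa [hs])) hz0)
      obtain ⟨v, hv, hvu, hX⟩ := split_exists T m k hs hloop hc z u hzT hzw (hev z hzT) hu
      have huz := hne u hu
      have hvz := hne v hv
      obtain ⟨m', hm'⟩ : ∃ m' : V → V → ℕ,
          m' + (dl z u + dl u z + dl z v + dl v z) = m + (dl u v + dl v u) := by
        refine ⟨m + (dl u v + dl v u) - (dl z u + dl u z + dl z v + dl v z), ?_⟩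
        rw [tsub_add_cancel_of_le]
        intro x y
        refine le_trans ?_ (Nat.le_add_right (m x y) _)
        have h1 := hs u z
        have h2 := hs v z
        simp only [dl, Pi.add_apply]
        split_ifs <;> grind
      have hp : ∀ x y, m' x y + (dl z u x y + dl u z x y + dl z v x y + dl v z x y) =
          m x y + (dl u v x y + dl v u x y) := fun x y => congrFun (congrFun hm' x) y
      have hcut : ∀ X, cut m' X + (cut (dl z u) X + cut (dl u z) X + cut (dl z v) X +
          cut (dl v z) X) = cut m X + (cut (dl u v) X + cut (dl v u) X) := by
        intro X
        simp only [← cut_add]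
        rw [hm']
      have hout : ∀ w, outd m' w + (outd (dl z u) w + outd (dl u z) w + outd (dl z v) w +
          outd (dl v z) w) = outd m w + (outd (dl u v) w + outd (dl v u) w) := by
        intro w
        simp only [← outd_add]
        rw [hm']
      have hout' : ∀ w, outd m' w + 2 * (if w = z then 1 else 0) = outd m w := by
        intro w
        have := hout w
        simp only [outd_dl] at this
        omega
      have hs' : ∀ a b, m' a b = m' b a := by
        intro a b
        have h1 := hp a b
        have h2 := hp b a
        rw [hs b a, hdlsymm z u b a, hdlsymm u z b a, hdlsymm z v b a, hdlsymm v z b a,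
          hdlsymm u v b a, hdlsymm v u b a] at h2
        omega
      have hcz : ∀ X, Spl T X → z ∉ X → 2 * k ≤ cut m' X := by
        intro X hXs hzX
        have h1 := hcut X
        have h2 := hc X hXs
        simp only [cut_dl] at h1
        by_cases p : u ∈ X <;> by_cases q : v ∈ X <;> simp [p, q, hzX] at h1
        · have := hX X hXs hzX p q
          omega
        all_goals omega
      obtain ⟨d', f1, f2, f3⟩ := ih T m' k (by
          have : ∑ w, (outd m' w + 2 * (if w = z then 1 else 0)) = ∑ w, outd m w :=
            Finset.sum_congr rfl fun w _ => hout' w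
          simp only [Finset.sum_add_distrib, ← Finset.mul_sum] at this
          simp at this
          omega)
        hs'
        (by
          intro w
          have h1 := hp w w
          have h2 := hl w
          rw [hdlsymm u z, hdlsymm v z, hdlsymm v u] at h1
          rw [Nat.even_iff] at h2 ⊢
          omega)
        (fun X hXs => by
          by_cases hzX : z ∈ X
          · rw [← cut_compl hs']
            exact hcz _ hXs.compl (by simpa using hzX)
          · exact hcz X hXs hzX)
        (fun w w' h1 h2 h3 h4 => hiso w w' h1 h2 (by rw [← hout']; omega) (by rw [← hout']; omega))
        (fun w hw => by
          have h2 := hev w hw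
          rw [← hout', Nat.even_add] at h2
          exact h2.2 (even_two_mul _))
      -- un-split
      have key : ∀ u v : V, u ≠ z → v ≠ z → (∀ x y, m' x y + (dl z u x y + dl u z x y + dl z v x y + dl v z x y) =
          m x y + (dl u v x y + dl v u x y)) → d' u v ≠ 0 →
          ∃ d : V → V → ℕ, (∀ x y, d x y + d y x = m x y) ∧ (∀ X, Spl T X → k ≤ cut d X) ∧
            ∀ w, w ∉ T → outd d w = ind d w := by
        intro u v huz hvz hp huv
        obtain ⟨d, hd⟩ : ∃ d : V → V → ℕ, d + dl u v = d' + (dl u z + dl z v) := by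
          refine ⟨d' + (dl u z + dl z v) - dl u v, ?_⟩
          rw [tsub_add_cancel_of_le]
          intro x y
          refine le_trans ?_ (Nat.le_add_right (d' x y) _)
          simp only [dl]
          split_ifs with h
          · obtain ⟨rfl, rfl⟩ := h
            omega
          · simp
        refine ⟨d, ?_, ?_, ?_⟩
        · intro x y
          have h1 : d x y + dl u v x y = d' x y + (dl u z x y + dl z v x y) :=
            congrFun (congrFun hd x) y
          have h2 : d y x + dl u v y x = d' y x + (dl u z y x + dl z v y x) :=
            congrFun (congrFun hd y) x
          have h3 := hp x y
          have h4 := f1 x y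
          rw [hdlsymm u v y x, hdlsymm u z y x, hdlsymm z v y x] at h2
          omega
        · intro X hX
          have h1 : cut (d + dl u v) X = _ := congrArg (fun f => cut f X) hd
          simp only [cut_add, cut_dl] at h1
          have h2 := f2 X hX
          by_cases p : u ∈ X <;> by_cases q : v ∈ X <;> by_cases r : z ∈ X <;>
            simp [p, q, r] at h1 <;> omega
        · intro w hw
          have h1 : outd (d + dl u v) w = _ := congrArg (fun f => outd f w) hd
          have h2 : ind (d + dl u v) w = _ := congrArg (fun f => ind f w) hd
          simp only [outd_add, ind_add, outd_dl, ind_dl] at h1 h2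
          have h3 := f3 w hw
          omega
      by_cases huv : d' u v ≠ 0
      · exact key u v huz hvz hp huv
      · refine key v u hvz huz (fun x y => by have := hp x y; omega) ?_
        have h1 := hp u v
        have h2 := f1 u v
        have e1 : dl u v u v = 1 := by simp [dl]
        have e2 : dl z u u v = 0 := by simp [dl, huz]
        have e3 : dl z v u v = 0 := by simp [dl, huz]
        have e4 : dl u z u v = 0 := by simp [dl, hvz]
        have e5 : dl v z u v = 0 := by simp [dl, hvz]
        omega
    push Not at hz
    have hT : ∀ a b, m a b ≠ 0 → a ∈ T := by
      intro a b hab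
      by_contra h
      exact hnz a b hab (hz a h)
    by_cases hm0 : ∀ a b, m a b = 0
    · refine ⟨fun _ _ => 0, by simp [hm0], ?_, by simp [outd, ind]⟩
      intro X hX
      have := hc X hX
      simp [cut, hm0] at this
      omega
    push Not at hm0
    by_cases hdel : ∃ a b, m a b ≠ 0 ∧
        ∀ X, Spl T X → a ∈ X → b ∉ X → 2 * k + 1 ≤ cut m X
    · -- delete the edge
      obtain ⟨a, b, hab, hX⟩ := hdel
      have haT := hT a b hab
      have hbT := hT b a (by rwa [hs])
      have hne : a ≠ b := by rintro rfl; exact hab (hloop _)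
      obtain ⟨m', hm'⟩ : ∃ m' : V → V → ℕ, m' + (dl a b + dl b a) = m := by
        refine ⟨m - (dl a b + dl b a), ?_⟩
        rw [tsub_add_cancel_of_le]
        intro x y
        have := hs a b
        simp only [dl, Pi.add_apply]
        split_ifs <;> grind
      have hp : ∀ x y, m' x y + (dl a b x y + dl b a x y) = m x y := fun x y =>
        congrFun (congrFun hm' x) y
      have hout : ∀ w, outd m w = outd m' w + (outd (dl a b) w + outd (dl b a) w) := by
        intro w
        rw [← hm', outd_add, outd_add]
      have hcut : ∀ X, cut m X = cut m' X + (cut (dl a b) X + cut (dl b a) X) := by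
        intro X
        rw [← hm', cut_add, cut_add]
      obtain ⟨d, f1, f2, f3⟩ := ih T m' k (by
          simp only [hout, Finset.sum_add_distrib, hsum] at hn
          omega)
        (by
          intro u v
          have h1 := hp u v
          have h2 := hp v u
          rw [hs v u, hdlsymm a b v u, hdlsymm b a v u] at h2
          omega)
        (by
          intro v
          have h1 := hp v v
          have h2 := hloop v
          have : m' v v = 0 := by omega
          simp [this])
        (fun X hXs => by
          have h1 := hcut X
          have h2 := hc X hXs
          simp only [cut_dl] at h1
          by_cases p : a ∈ X <;> by_cases q : b ∈ X <;> simp [p, q] at h1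
          · omega
          · have := hX X hXs p q
            omega
          · have := hX Xᶜ hXs.compl (by simpa using p) (by simpa using q)
            rw [cut_compl hs] at this
            omega
          · omega)
        (fun w w' h1 h2 h3 h4 => hiso w w' h1 h2 (by rw [hout]; omega) (by rw [hout]; omega))
        (fun w hw => by
          have h1 := hout w
          have h2 := hz w hw
          have : outd m' w = 0 := by omega
          simp [this])
      refine ⟨d + dl a b, ?_, ?_, ?_⟩
      · intro x y
        have h1 := f1 x y
        have h2 := hp x y
        have h3 := hdlsymm a b y x
        simp only [Pi.add_apply]
        omega
      · intro X hX
        rw [cut_add]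
        have := f2 X hX
        omega
      · intro w hw
        have h1 : w ≠ a := by rintro rfl; exact hw haT
        have h2 : w ≠ b := by rintro rfl; exact hw hbT
        rw [outd_add, ind_add, outd_dl, ind_dl, f3 w hw]
        simp [h1, h2]
    push Not at hdel
    have htight : ∀ a b, m a b ≠ 0 → ∃ X, Spl T X ∧ cut m X = 2 * k ∧ a ∈ X ∧ b ∉ X := by
      intro a b hab
      obtain ⟨X, h1, h2, h3, h4⟩ := hdel a b hab
      have := hc X h1
      exact ⟨X, h1, by omega, h2, h3⟩
    have hk : 0 < k := by
      obtain ⟨a, b, hab⟩ := hm0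
      obtain ⟨X, h1, h2, h3, h4⟩ := htight a b hab
      by_contra hk0
      have h5 : cut m X = 0 := by rw [h2]; omega
      unfold cut at h5
      rw [Finset.sum_eq_zero_iff] at h5
      have h6 := h5 a (Finset.mem_univ _)
      rw [Finset.sum_eq_zero_iff] at h6
      have h7 := h6 b (Finset.mem_univ _)
      simp [h3, h4] at h7
      exact hab h7
    obtain ⟨z, hzT, hzd⟩ := exists_deg T m k hk hs hloop hc hT htight hm0
    obtain ⟨d, f1, f2, f3⟩ := ih (T.erase z) m k (by
        have := Finset.card_erase_lt_of_mem hzT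
        omega) hs hl
      (fun X hX => by
        obtain ⟨⟨a, ha, haX⟩, b, hb, hbX⟩ := hX
        exact hc X ⟨⟨a, Finset.mem_of_mem_erase ha, haX⟩, b, Finset.mem_of_mem_erase hb, hbX⟩)
      (fun w w' h1 h2 h3 h4 => by
        have : ∀ w, w ∉ T.erase z → outd m w ≠ 0 → w = z := by
          intro w h1 h2
          by_contra h
          exact h2 (hz w fun h' => h1 (Finset.mem_erase.2 ⟨h, h'⟩))
        rw [this w h1 h3, this w' h2 h4])
      (fun w hw => by
        by_cases h : w = z
        · rw [h, hzd]; simp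
        · rw [hz w fun h' => hw (Finset.mem_erase.2 ⟨h, h'⟩)]; simp)
    have hdz : outd d z = ind d z := f3 z (by simp)
    have hdz2 : outd d z + ind d z = 2 * k := by
      rw [← hzd]
      unfold outd ind
      rw [← Finset.sum_add_distrib]
      exact Finset.sum_congr rfl fun w _ => f1 z w
    have hd0 : d z z = 0 := by
      have := f1 z z
      rw [hloop z] at this
      omega
    have hdT : ∀ a b, d a b ≠ 0 → a ∈ T ∧ b ∈ T := by
      intro a b hab
      have h1 := f1 a b
      have h2 : m a b ≠ 0 := by omega
      exact ⟨hT a b h2, hT b a (by rwa [hs])⟩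
    refine ⟨d, f1, ?_, fun w hw => f3 w fun h => hw (Finset.mem_of_mem_erase h)⟩
    intro X hX
    by_cases hXs : Spl (T.erase z) X
    · exact f2 X hXs
    by_cases hzX : z ∈ X
    · have hcon : ∀ a ∈ T, a ∈ X → a = z := by
        intro a ha haX
        by_contra hne
        obtain ⟨_, b, hb, hbX⟩ := hX
        exact hXs ⟨⟨a, by simp [hne, ha], haX⟩, b, by
          simp only [Finset.mem_erase]
          exact ⟨by rintro rfl; exact hbX hzX, hb⟩, hbX⟩
      have : cut d X = cut d {z} := by
        apply cut_congr
        intro p q hpq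
        obtain ⟨hp, hq⟩ := hdT p q hpq
        simp only [Finset.mem_singleton]
        exact ⟨⟨fun h => hcon p hp h, fun h => by rw [h]; exact hzX⟩,
          ⟨fun h => hcon q hq h, fun h => by rw [h]; exact hzX⟩⟩
      rw [this, cut_single d z hd0]
      omega
    · have hcon : ∀ a ∈ T, a ∉ X → a = z := by
        intro a ha haX
        by_contra hne
        obtain ⟨⟨b, hb, hbX⟩, _⟩ := hX
        exact hXs ⟨⟨b, by
          simp only [Finset.mem_erase]
          exact ⟨by rintro rfl; exact hzX hbX, hb⟩, hbX⟩, a, by simp [hne, ha], haX⟩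
      have : cut d X = cut d {z}ᶜ := by
        apply cut_congr
        intro p q hpq
        obtain ⟨hp, hq⟩ := hdT p q hpq
        simp only [Finset.mem_compl, Finset.mem_singleton]
        exact ⟨⟨fun h h' => hzX (h' ▸ h), fun h => by by_contra h'; exact h (hcon p hp h')⟩,
          ⟨fun h h' => hzX (h' ▸ h), fun h => by by_contra h'; exact h (hcon q hq h')⟩⟩
      rw [this, cut_single_compl d z hd0]
      omega

end NW

/-- Nash-Williams: every `2k`-edge-connected multigraph has a `k`-arc-strong
orientation in which in-degree and out-degree differ by at most 1 at every
vertex. -/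
theorem nash_williams_orientation
    {V : Type} [Fintype V] (m : V → V → ℕ)
    (hsymm : ∀ u v, m u v = m v u) (hloop : ∀ v, m v v = 0)
    (k : ℕ) (hconn : MultigraphEdgeConn m (2 * k)) :
    ∃ d : V → V → ℕ,
      (∀ u v, d u v + d v u = m u v) ∧
      ArcStrong d k ∧
      ∀ v : V, |((∑ w : V, d v w : ℤ) - (∑ w : V, d w v : ℤ))| ≤ 1 := by
  classical
  have hcut : ∀ X : Finset V, NW.Spl Finset.univ X → 2 * k ≤ NW.cut m X := by
    rintro X ⟨⟨x, _, hx⟩, y, _, hy⟩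
    by_contra hlt
    have hpath := hconn
      (fun u v => (if u ∈ X ∧ v ∉ X then m u v else 0) + (if u ∈ Xᶜ ∧ v ∉ Xᶜ then m u v else 0))
      (by
        intro u v
        rw [hsymm u v]
        by_cases p : u ∈ X <;> by_cases q : v ∈ X <;> simp [p, q])
      (by
        intro u v
        by_cases p : u ∈ X <;> by_cases q : v ∈ X <;> simp [p, q])
      (by
        simp only [Finset.sum_add_distrib]
        have h1 := NW.cut_compl hsymm X
        unfold NW.cut at h1 hlt
        omega) x y
    apply hy
    clear hy
    induction hpath with
    | refl => exact hx
    | @tail a b _ hr ih =>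
      by_contra hb
      simp [ih, hb] at hr
  obtain ⟨d, h1, h2, _⟩ := NW.orient _ Finset.univ m k le_rfl hsymm (by simp [hloop]) hcut
    (by simp) (by simp)
  obtain ⟨d', e1, e2, e3⟩ := NW.smooth (∑ w, (NW.imb d w) ^ 2).toNat d k h2 (Int.self_le_toNat _)
  refine ⟨d', fun u v => by rw [e1, h1], ?_, ?_⟩
  · intro r hr hsum x y
    by_contra hcon
    obtain ⟨X, hx, hy, hle⟩ := NW.cut_reach d' r (fun a b h => not_lt.1 h) hcon
    have h3 := e2 X ⟨⟨x, by simp, hx⟩, y, by simp, hy⟩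
    have h4 := NW.cut_le_sum r X
    omega
  · intro v
    have := e3 v
    unfold NW.imb NW.outd NW.ind at this
    push_cast at this
    exact this
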